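/- arXiv:1604.06637 — 2 statements merged into one kernel-verified Lean document; each statement's English description precedes it below -/
import Mathlib

section
/- Theorem 1(ii) (identifiability of the γ-divergence for regression): assume the three integrals ∫∫ g(y|x) f(y|x)^γ g(x) dy dx, ∫∫ g(y|x)^{1+γ} g(x) dy dx and ∫∫ f(y|x)^{1+γ} g(x) dy dx are finite and positive. Then D_γ(g(y|x), f(y|x); g(x)) = 0 if and only if g(y|x) = f(y|x) for almost every (x,y) with respect to the measure g(x)dx⊗dy. -/
open MeasureTheory
open scoped ENNReal

/-- The double integral `∫∫ p(y|x) f(y|x)^γ w(x) dy dx` in `ℝ≥0∞`;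
`J d γ f f w = ∫∫ f(y|x)^{1+γ} w(x) dy dx`. -/
noncomputable def J (d : ℕ) (γ : ℝ) (p f : (Fin d → ℝ) → ℝ → ℝ)
    (w : (Fin d → ℝ) → ℝ) : ℝ≥0∞ :=
  ∫⁻ x : Fin d → ℝ,
    (∫⁻ y : ℝ, ENNReal.ofReal (p x y) * ENNReal.ofReal (f x y) ^ γ) *
      ENNReal.ofReal (w x)

/-- The γ-cross entropy for regression with base weight `w`:
`d_γ(p,f;w) = -(1/γ) log ∫∫ p f^γ w + (1/(1+γ)) log ∫∫ f^{1+γ} w`. -/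
noncomputable def dgam (d : ℕ) (γ : ℝ) (p f : (Fin d → ℝ) → ℝ → ℝ)
    (w : (Fin d → ℝ) → ℝ) : ℝ :=
  -(1 / γ) * Real.log (J d γ p f w).toReal +
    (1 / (1 + γ)) * Real.log (J d γ f f w).toReal

/-- The γ-divergence for regression: `D_γ(p,f;w) = d_γ(p,f;w) - d_γ(p,p;w)`. -/
noncomputable def Dgam (d : ℕ) (γ : ℝ) (p f : (Fin d → ℝ) → ℝ → ℝ)
    (w : (Fin d → ℝ) → ℝ) : ℝ :=
  dgam d γ p f w - dgam d γ p p w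

/-- Equality case of Hölder's inequality for normalized functions. -/
theorem ae_rpow_eq_rpow_of_lintegral_mul_eq_one {α : Type*} [MeasurableSpace α] {μ : Measure α}
    {p q : ℝ} (hpq : p.HolderConjugate q) {a b : α → ℝ≥0∞}
    (ha : AEMeasurable a μ) (hb : AEMeasurable b μ)
    (hap : ∫⁻ z, a z ^ p ∂μ = 1) (hbq : ∫⁻ z, b z ^ q ∂μ = 1)
    (hab : ∫⁻ z, a z * b z ∂μ = 1) : ∀ᵐ z ∂μ, a z ^ p = b z ^ q := by
  have hsum : ∫⁻ z, (a z ^ p / ENNReal.ofReal p + b z ^ q / ENNReal.ofReal q) ∂μ = 1 := by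
    simp_rw [div_eq_mul_inv]
    rw [lintegral_add_left' (by fun_prop), lintegral_mul_const'' _ (by fun_prop),
      lintegral_mul_const'' _ (by fun_prop), hap, hbq, one_mul, one_mul]
    exact hpq.inv_add_inv_ennreal
  have heq := ae_eq_of_ae_le_of_lintegral_le
    (ae_of_all μ fun z => ENNReal.young_inequality (a z) (b z) hpq)
    (by rw [hab]; exact ENNReal.one_ne_top) (by fun_prop) (by rw [hab, hsum])
  have hatop := ae_lt_top' (ha.pow_const p) (by rw [hap]; exact ENNReal.one_ne_top)
  have hbtop := ae_lt_top' (hb.pow_const q) (by rw [hbq]; exact ENNReal.one_ne_top)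
  filter_upwards [heq, hatop, hbtop] with z hz hza hzb
  rcases (ENNReal.young_inequality_eq_iff _ _ hpq).1 hz with h | h | h
  · simp [h.1, hpq.pos] at hza
  · simp [h.2, hpq.symm.pos] at hzb
  · exact h

/-- Equality case of Hölder's inequality: proportionality of the `p`-th and `q`-th powers. -/
theorem ae_rpow_mul_inv_eq_of_lintegral_mul_eq {α : Type*} [MeasurableSpace α] {μ : Measure α}
    {p q : ℝ} (hpq : p.HolderConjugate q) {a b : α → ℝ≥0∞}
    (ha : AEMeasurable a μ) (hb : AEMeasurable b μ) {A B : ℝ≥0∞}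
    (hA0 : A ≠ 0) (hA : A ≠ ⊤) (hB0 : B ≠ 0) (hB : B ≠ ⊤)
    (hap : ∫⁻ z, a z ^ p ∂μ = A) (hbq : ∫⁻ z, b z ^ q ∂μ = B)
    (hab : ∫⁻ z, a z * b z ∂μ = A ^ p⁻¹ * B ^ q⁻¹) :
    ∀ᵐ z ∂μ, a z ^ p * A⁻¹ = b z ^ q * B⁻¹ := by
  have key : ∀ (x D : ℝ≥0∞) {r : ℝ}, 0 < r → (x * (D ^ r⁻¹)⁻¹) ^ r = x ^ r * D⁻¹ := by
    intro x D r hr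
    rw [ENNReal.mul_rpow_of_nonneg _ _ hr.le, ENNReal.inv_rpow, ← ENNReal.rpow_mul,
      inv_mul_cancel₀ hr.ne', ENNReal.rpow_one]
  have h := ae_rpow_eq_rpow_of_lintegral_mul_eq_one hpq (μ := μ)
    (a := fun z => a z * (A ^ p⁻¹)⁻¹) (b := fun z => b z * (B ^ q⁻¹)⁻¹)
    (by fun_prop) (by fun_prop) ?_ ?_ ?_
  · filter_upwards [h] with z hz
    rwa [key _ _ hpq.pos, key _ _ hpq.symm.pos] at hz
  · simp_rw [key _ _ hpq.pos]
    rw [lintegral_mul_const'' _ (by fun_prop), hap, ENNReal.mul_inv_cancel hA0 hA]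
  · simp_rw [key _ _ hpq.symm.pos]
    rw [lintegral_mul_const'' _ (by fun_prop), hbq, ENNReal.mul_inv_cancel hB0 hB]
  · simp_rw [mul_mul_mul_comm]
    rw [lintegral_mul_const'' _ (by fun_prop), hab, mul_mul_mul_comm,
      ENNReal.mul_inv_cancel (ENNReal.rpow_pos (pos_iff_ne_zero.2 hA0) hA).ne'
        (ENNReal.rpow_ne_top_of_ne_zero hA0 hA),
      ENNReal.mul_inv_cancel (ENNReal.rpow_pos (pos_iff_ne_zero.2 hB0) hB).ne'
        (ENNReal.rpow_ne_top_of_ne_zero hB0 hB),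
      one_mul]

theorem J_eq_lintegral_prod {d : ℕ} {γ : ℝ} {p f : (Fin d → ℝ) → ℝ → ℝ} {w : (Fin d → ℝ) → ℝ}
    (hp : Measurable (Function.uncurry p)) (hf : Measurable (Function.uncurry f))
    (hw : Measurable w) :
    J d γ p f w = ∫⁻ z : (Fin d → ℝ) × ℝ,
      ENNReal.ofReal (p z.1 z.2) * ENNReal.ofReal (f z.1 z.2) ^ γ
        ∂((volume.withDensity fun x => ENNReal.ofReal (w x)).prod (volume : Measure ℝ)) := by
  have hm : Measurable fun z : (Fin d → ℝ) × ℝ =>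
      ENNReal.ofReal (p z.1 z.2) * ENNReal.ofReal (f z.1 z.2) ^ γ :=
    hp.ennreal_ofReal.mul (hf.ennreal_ofReal.pow_const γ)
  rw [lintegral_prod _ hm.aemeasurable,
    lintegral_withDensity_eq_lintegral_mul _ hw.ennreal_ofReal hm.lintegral_prod_right', J]
  exact lintegral_congr fun x => mul_comm _ _

theorem ENNReal.mul_rpow_self {γ : ℝ} (hγ : 0 < γ) (x : ℝ≥0∞) : x * x ^ γ = x ^ (1 + γ) := by
  rw [ENNReal.rpow_add_of_nonneg _ _ zero_le_one hγ.le, ENNReal.rpow_one]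

/-- Vanishing of the γ-divergence is equality in Hölder's inequality. -/
theorem J_eq_of_Dgam_eq_zero {d : ℕ} {γ : ℝ} (hγ : 0 < γ) {p f : (Fin d → ℝ) → ℝ → ℝ}
    {w : (Fin d → ℝ) → ℝ}
    (hpf0 : J d γ p f w ≠ 0) (hpf : J d γ p f w ≠ ⊤)
    (hpp0 : J d γ p p w ≠ 0) (hpp : J d γ p p w ≠ ⊤)
    (hff0 : J d γ f f w ≠ 0) (hff : J d γ f f w ≠ ⊤) (h : Dgam d γ p f w = 0) :
    J d γ p f w = J d γ p p w ^ (1 + γ)⁻¹ * J d γ f f w ^ ((1 + γ) / γ)⁻¹ := by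
  have hA := ENNReal.toReal_pos hpp0 hpp
  have hB := ENNReal.toReal_pos hff0 hff
  have hC := ENNReal.toReal_pos hpf0 hpf
  have hγ1 : 0 < 1 + γ := by linarith
  rw [← ENNReal.toReal_eq_toReal_iff' hpf
    (ENNReal.mul_ne_top (ENNReal.rpow_ne_top_of_ne_zero hpp0 hpp)
      (ENNReal.rpow_ne_top_of_ne_zero hff0 hff)),
    ENNReal.toReal_mul, ← ENNReal.toReal_rpow, ← ENNReal.toReal_rpow]
  refine Real.log_injOn_pos hC
    (mul_pos (Real.rpow_pos_of_pos hA _) (Real.rpow_pos_of_pos hB _)) ?_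
  rw [Real.log_mul (Real.rpow_pos_of_pos hA _).ne' (Real.rpow_pos_of_pos hB _).ne',
    Real.log_rpow hA, Real.log_rpow hB]
  unfold Dgam dgam at h
  field_simp at h ⊢
  linarith

/-- Theorem 1(ii): `D_γ(g(y|x),f(y|x);g(x)) = 0` iff `g(y|x) = f(y|x)` for almost
every `(x,y)` with respect to the measure `g(x)dx ⊗ dy`. -/
theorem gamma_divergence_eq_zero_iff {d : ℕ} {γ : ℝ} (hγ : 0 < γ)
    (g f : (Fin d → ℝ) → ℝ → ℝ) (gx : (Fin d → ℝ) → ℝ)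
    (hg_meas : Measurable (Function.uncurry g))
    (hf_meas : Measurable (Function.uncurry f))
    (hgx_meas : Measurable gx)
    (hg_nonneg : ∀ x y, 0 ≤ g x y) (hf_nonneg : ∀ x y, 0 ≤ f x y)
    (hgx_nonneg : ∀ x, 0 ≤ gx x)
    (hg_dens : ∀ᵐ x : Fin d → ℝ ∂volume, ∫ y : ℝ, g x y = 1)
    (hf_dens : ∀ᵐ x : Fin d → ℝ ∂volume, ∫ y : ℝ, f x y = 1)
    (hgx_int : Integrable gx) (hgx_prob : ∫ x : Fin d → ℝ, gx x = 1)
    (hgf_pos : 0 < J d γ g f gx) (hgf_fin : J d γ g f gx ≠ ⊤)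
    (hgg_pos : 0 < J d γ g g gx) (hgg_fin : J d γ g g gx ≠ ⊤)
    (hff_pos : 0 < J d γ f f gx) (hff_fin : J d γ f f gx ≠ ⊤) :
    Dgam d γ g f gx = 0 ↔
      (∀ᵐ p : (Fin d → ℝ) × ℝ
          ∂((volume.withDensity fun x => ENNReal.ofReal (gx x)).prod
            (volume : Measure ℝ)),
        g p.1 p.2 = f p.1 p.2) := by
  have hγ1 : 0 < 1 + γ := by linarith
  set μ := volume.withDensity fun x => ENNReal.ofReal (gx x) with hμ
  have hac : μ ≪ volume := withDensity_absolutelyContinuous _ _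
  constructor
  · intro h
    have hC := J_eq_of_Dgam_eq_zero hγ hgf_pos.ne' hgf_fin hgg_pos.ne' hgg_fin
      hff_pos.ne' hff_fin h
    have hpq : (1 + γ).HolderConjugate ((1 + γ) / γ) := by
      rw [Real.holderConjugate_iff]
      exact ⟨by linarith, by field_simp⟩
    have hbq (x : ℝ≥0∞) : (x ^ γ) ^ ((1 + γ) / γ) = x ^ (1 + γ) := by
      rw [← ENNReal.rpow_mul, mul_div_cancel₀ _ hγ.ne']
    have hG : Measurable fun z : (Fin d → ℝ) × ℝ => ENNReal.ofReal (g z.1 z.2) :=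
      hg_meas.ennreal_ofReal
    have hF : Measurable fun z : (Fin d → ℝ) × ℝ => ENNReal.ofReal (f z.1 z.2) :=
      hf_meas.ennreal_ofReal
    have hprop := ae_rpow_mul_inv_eq_of_lintegral_mul_eq (μ := μ.prod volume) hpq
      hG.aemeasurable (hF.pow_const γ).aemeasurable
      hgg_pos.ne' hgg_fin hff_pos.ne' hff_fin
      (by simp_rw [J_eq_lintegral_prod hg_meas hg_meas hgx_meas, ENNReal.mul_rpow_self hγ]; rfl)
      (by
        simp_rw [J_eq_lintegral_prod hf_meas hf_meas hgx_meas, ENNReal.mul_rpow_self hγ, hbq]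
        rfl)
      (by rw [← hC, J_eq_lintegral_prod hg_meas hf_meas hgx_meas])
    set A := J d γ g g gx
    set B := J d γ f f gx
    obtain ⟨c, hc⟩ : ∃ c : ℝ, ∀ᵐ z ∂μ.prod volume, g z.1 z.2 = c * f z.1 z.2 := by
      refine ⟨((A * B⁻¹) ^ (1 + γ)⁻¹).toReal, ?_⟩
      filter_upwards [hprop] with z hz
      rw [hbq] at hz
      have h1 : ENNReal.ofReal (g z.1 z.2) ^ (1 + γ) =
          A * B⁻¹ * ENNReal.ofReal (f z.1 z.2) ^ (1 + γ) := by
        rw [← mul_one (_ ^ (1 + γ)), ← ENNReal.inv_mul_cancel hgg_pos.ne' hgg_fin, ← mul_assoc, hz]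
        ring
      have h2 := congrArg (fun t => (t ^ (1 + γ)⁻¹).toReal) h1
      simpa [ENNReal.mul_rpow_of_nonneg _ _ (inv_nonneg.2 hγ1.le), ← ENNReal.rpow_mul,
        mul_inv_cancel₀ hγ1.ne', hg_nonneg, hf_nonneg] using h2
    have hμ0 : μ ≠ 0 := by
      intro h0
      apply hgg_pos.ne'
      change J d γ g g gx = 0
      rw [J_eq_lintegral_prod hg_meas hg_meas hgx_meas, ← hμ, h0]
      simp
    have : (ae μ).NeBot := ae_neBot.2 hμ0
    obtain ⟨x, hx, hgx1, hfx1⟩ := ((Measure.ae_ae_of_ae_prod hc).and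
      (Filter.Eventually.and (hac.ae_le hg_dens) (hac.ae_le hf_dens))).exists
    have hc1 : c = 1 := by
      have := integral_congr_ae hx
      simpa only [integral_const_mul, hgx1, hfx1, mul_one] using this.symm
    filter_upwards [hc] with z hz
    rw [hz, hc1, one_mul]
  · intro h
    have hfg : J d γ g f gx = J d γ g g gx := by
      rw [J_eq_lintegral_prod hg_meas hf_meas hgx_meas,
        J_eq_lintegral_prod hg_meas hg_meas hgx_meas]
      refine lintegral_congr_ae ?_
      filter_upwards [h] with z hz
      rw [hz]
    have hff : J d γ f f gx = J d γ g g gx := by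
      rw [J_eq_lintegral_prod hf_meas hf_meas hgx_meas,
        J_eq_lintegral_prod hg_meas hg_meas hgx_meas]
      refine lintegral_congr_ae ?_
      filter_upwards [h] with z hz
      rw [hz]
    unfold Dgam dgam
    rw [hfg, hff, sub_self]
end

section
/- Theorem 3 (approximate Pythagorean relation under heterogeneous contamination, quantitative form): under heterogeneous contamination g(y|x) = (1−ε(x)) f*(y|x) + ε(x) δ(y|x) with ε: ℝ^d→[0,1) measurable and ∫ ε(x) g(x) dx < 1, suppose both f(y|x) = (1/σ) s((y−q(x))/σ) and f*(y|x) = (1/σ*) s((y−q*(x))/σ*) are location-scale conditional densities with ∫ s^{1+γ} ∈ (0,∞). Let A_f := ∫∫ f* f^γ (1−ε(x)) g(x) dy dx, A_* := ∫∫ (f*)^{1+γ} (1−ε(x)) g(x) dy dx, T_f := ∫ ν_{f,γ}(x)^γ ε(x) g(x) dx, T_* := ∫ ν_{f*,γ}(x)^γ ε(x) g(x) dx, and assume A_f, A_* ∈ (0,∞) and T_f, T_* < ∞. Then |D_γ(g, f; g(x)) − D_γ(g, f*; g(x)) − D_γ(f*, f; (1−ε(x))g(x))| ≤ (1/γ)(T_f/A_f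 + T_*/A_*), where D_γ with base measure (1−ε(x))g(x) is defined by replacing g(x)dx with (1−ε(x))g(x)dx in the γ-cross entropies. -/
open MeasureTheory
open scoped ENNReal

/-- For a location-scale family with `0 < ∫ s^{1+γ} < ∞`, the inner integral `∫ f(y|x)^{1+γ} dy`
is a positive finite constant, so that `J d γ f f w` is proportional to the total mass of `w`. -/
lemma exists_J_self_eq_mul_lintegral {d : ℕ} {γ : ℝ} (hγ : 0 < γ) {s : ℝ → ℝ}
    (hs_nonneg : ∀ z, 0 ≤ s z) (hs_pow_int : Integrable fun z : ℝ => s z ^ (1 + γ))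
    (hs_pow_pos : 0 < ∫ z : ℝ, s z ^ (1 + γ)) {σ : ℝ} (hσ : 0 < σ)
    (q : (Fin d → ℝ) → ℝ) (f : (Fin d → ℝ) → ℝ → ℝ)
    (hf : ∀ x y, f x y = (1 / σ) * s ((y - q x) / σ)) :
    ∃ C : ℝ≥0∞, 0 < C ∧ C ≠ ⊤ ∧ ∀ w : (Fin d → ℝ) → ℝ, Measurable w →
      J d γ f f w = C * ∫⁻ x, ENNReal.ofReal (w x) := by
  refine ⟨ENNReal.ofReal ((1 / σ) ^ (1 + γ) * (σ * ∫ z, s z ^ (1 + γ))),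
    ENNReal.ofReal_pos.2 (by positivity), ENNReal.ofReal_ne_top, fun w hw => ?_⟩
  rw [← lintegral_const_mul _ hw.ennreal_ofReal]
  refine lintegral_congr fun x => ?_
  congr 1
  have h_int : Integrable fun y => (1 / σ) ^ (1 + γ) * s ((y - q x) / σ) ^ (1 + γ) :=
    ((hs_pow_int.comp_div hσ.ne').comp_sub_right (q x)).const_mul _
  have h_val : ∫ y, (1 / σ) ^ (1 + γ) * s ((y - q x) / σ) ^ (1 + γ) =
      (1 / σ) ^ (1 + γ) * (σ * ∫ z, s z ^ (1 + γ)) := by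
    rw [integral_const_mul,
      integral_sub_right_eq_self (fun y => s (y / σ) ^ (1 + γ)) (q x),
      Measure.integral_comp_div (fun y => s y ^ (1 + γ)) σ, abs_of_pos hσ, smul_eq_mul]
  rw [← h_val, ofReal_integral_eq_lintegral_ofReal h_int
    (ae_of_all _ fun y => mul_nonneg (by positivity) (Real.rpow_nonneg (hs_nonneg _) _))]
  refine lintegral_congr fun y => ?_
  have h_nonneg : 0 ≤ f x y := by
    rw [hf]
    exact mul_nonneg (by positivity) (hs_nonneg _)
  rw [← Real.mul_rpow (by positivity) (hs_nonneg _), ← hf,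
    ENNReal.ofReal_rpow_of_nonneg h_nonneg hγ.le, ← ENNReal.ofReal_mul h_nonneg,
    Real.rpow_add_of_nonneg h_nonneg zero_le_one hγ.le, Real.rpow_one]

/-- The cross integral `J` splits along a heterogeneous mixture in its first argument. -/
lemma J_mixture {d : ℕ} {γ : ℝ} {p δ g f : (Fin d → ℝ) → ℝ → ℝ} {w ε : (Fin d → ℝ) → ℝ}
    (hp_meas : Measurable (Function.uncurry p)) (hδ_meas : Measurable (Function.uncurry δ))
    (hf_meas : Measurable (Function.uncurry f)) (hw_meas : Measurable w)
    (hε_meas : Measurable ε) (hε_nonneg : ∀ x, 0 ≤ ε x) (hε_le : ∀ x, ε x ≤ 1)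
    (hp_nonneg : ∀ x y, 0 ≤ p x y) (hδ_nonneg : ∀ x y, 0 ≤ δ x y)
    (hg : ∀ x y, g x y = (1 - ε x) * p x y + ε x * δ x y) :
    J d γ g f w = J d γ p f (fun x => (1 - ε x) * w x) + J d γ δ f (fun x => ε x * w x) := by
  have h_meas {r : (Fin d → ℝ) → ℝ → ℝ} (hr : Measurable (Function.uncurry r)) :
      Measurable fun z : (Fin d → ℝ) × ℝ =>
        ENNReal.ofReal (r z.1 z.2) * ENNReal.ofReal (f z.1 z.2) ^ γ :=
    hr.ennreal_ofReal.mul (hf_meas.ennreal_ofReal.pow_const γ)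
  have hp := h_meas hp_meas
  have hδ := h_meas hδ_meas
  have h_left : Measurable fun x =>
      (∫⁻ y, ENNReal.ofReal (p x y) * ENNReal.ofReal (f x y) ^ γ) *
        ENNReal.ofReal ((1 - ε x) * w x) :=
    hp.lintegral_prod_right'.mul ((measurable_const.sub hε_meas).mul hw_meas).ennreal_ofReal
  unfold J
  rw [← lintegral_add_left h_left]
  refine lintegral_congr fun x => ?_
  have h_one_sub : 0 ≤ 1 - ε x := sub_nonneg.2 (hε_le x)
  have hpx : Measurable fun y =>
      ENNReal.ofReal (p x y) * ENNReal.ofReal (f x y) ^ γ := hp.comp measurable_prodMk_left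
  have hδx : Measurable fun y =>
      ENNReal.ofReal (δ x y) * ENNReal.ofReal (f x y) ^ γ := hδ.comp measurable_prodMk_left
  have h_inner : ∫⁻ y, ENNReal.ofReal (g x y) * ENNReal.ofReal (f x y) ^ γ =
      ENNReal.ofReal (1 - ε x) *
          (∫⁻ y, ENNReal.ofReal (p x y) * ENNReal.ofReal (f x y) ^ γ) +
        ENNReal.ofReal (ε x) *
          ∫⁻ y, ENNReal.ofReal (δ x y) * ENNReal.ofReal (f x y) ^ γ := by
    rw [← lintegral_const_mul _ hpx, ← lintegral_const_mul _ hδx,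
      ← lintegral_add_left (hpx.const_mul _)]
    refine lintegral_congr fun y => ?_
    rw [hg, ENNReal.ofReal_add (mul_nonneg h_one_sub (hp_nonneg x y))
      (mul_nonneg (hε_nonneg x) (hδ_nonneg x y)), ENNReal.ofReal_mul h_one_sub,
      ENNReal.ofReal_mul (hε_nonneg x)]
    ring
  rw [h_inner, ENNReal.ofReal_mul h_one_sub, ENNReal.ofReal_mul (hε_nonneg x)]
  ring

/-- Adding a nonnegative `t` to a positive `a` moves the logarithm by an amount in
`[0, t / a]`. -/
lemma log_add_sub_log_mem_Icc {a t : ℝ} (ha : 0 < a) (ht : 0 ≤ t) :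
    Real.log (a + t) - Real.log a ∈ Set.Icc 0 (t / a) := by
  refine ⟨sub_nonneg.2 (Real.log_le_log ha (by linarith)), ?_⟩
  rw [← Real.log_div (by positivity) ha.ne']
  refine (Real.log_le_sub_one_of_pos (by positivity)).trans_eq ?_
  field_simp
  ring

/-- Theorem 3 (approximate Pythagorean relation under heterogeneous contamination,
quantitative form):
`|D_γ(g,f;g(x)) − D_γ(g,f*;g(x)) − D_γ(f*,f;(1−ε(x))g(x))|
  ≤ (1/γ)(T_f/A_f + T_*/A_*)`. -/
theorem pythagorean_heterogeneous {d : ℕ} {γ : ℝ} (hγ : 0 < γ)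
    (δ g : (Fin d → ℝ) → ℝ → ℝ) (gx : (Fin d → ℝ) → ℝ)
    (ε : (Fin d → ℝ) → ℝ) (hε_meas : Measurable ε)
    (hε_nonneg : ∀ x, 0 ≤ ε x) (hε_lt : ∀ x, ε x < 1)
    (hδ_meas : Measurable (Function.uncurry δ))
    (hgx_meas : Measurable gx)
    (hδ_nonneg : ∀ x y, 0 ≤ δ x y) (hgx_nonneg : ∀ x, 0 ≤ gx x)
    (hδ_dens : ∀ᵐ x : Fin d → ℝ ∂volume, ∫ y : ℝ, δ x y = 1)
    (hgx_int : Integrable gx) (hgx_prob : ∫ x : Fin d → ℝ, gx x = 1)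
    (hεg_lt : ∫ x : Fin d → ℝ, ε x * gx x < 1)
    -- both f and f* are location-scale families with common density s
    (s : ℝ → ℝ) (hs_meas : Measurable s) (hs_nonneg : ∀ z, 0 ≤ s z)
    (hs_prob : ∫ z : ℝ, s z = 1)
    (hs_pow_int : Integrable fun z : ℝ => s z ^ (1 + γ))
    (hs_pow_pos : 0 < ∫ z : ℝ, s z ^ (1 + γ))
    (σ σstar : ℝ) (hσ : 0 < σ) (hσstar : 0 < σstar)
    (q qstar : (Fin d → ℝ) → ℝ) (hq : Measurable q) (hqstar : Measurable qstar)
    (f fstar : (Fin d → ℝ) → ℝ → ℝ)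
    (hf : ∀ x y, f x y = (1 / σ) * s ((y - q x) / σ))
    (hfstar : ∀ x y, fstar x y = (1 / σstar) * s ((y - qstar x) / σstar))
    -- heterogeneous contamination
    (hg : ∀ x y, g x y = (1 - ε x) * fstar x y + ε x * δ x y)
    -- finiteness and positivity assumptions
    (hAf_pos : 0 < J d γ fstar f (fun x => (1 - ε x) * gx x))
    (hAf_fin : J d γ fstar f (fun x => (1 - ε x) * gx x) ≠ ⊤)
    (hAs_pos : 0 < J d γ fstar fstar (fun x => (1 - ε x) * gx x))
    (hAs_fin : J d γ fstar fstar (fun x => (1 - ε x) * gx x) ≠ ⊤)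
    (hTf_fin : J d γ δ f (fun x => ε x * gx x) ≠ ⊤)
    (hTs_fin : J d γ δ fstar (fun x => ε x * gx x) ≠ ⊤) :
    |Dgam d γ g f gx - Dgam d γ g fstar gx -
        Dgam d γ fstar f (fun x => (1 - ε x) * gx x)| ≤
      (1 / γ) *
        ((J d γ δ f (fun x => ε x * gx x)).toReal /
            (J d γ fstar f (fun x => (1 - ε x) * gx x)).toReal +
          (J d γ δ fstar (fun x => ε x * gx x)).toReal /
            (J d γ fstar fstar (fun x => (1 - ε x) * gx x)).toReal) := by
  have h_meas {τ : ℝ} {r : (Fin d → ℝ) → ℝ} (hr : Measurable r)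
      {p : (Fin d → ℝ) → ℝ → ℝ} (hp : ∀ x y, p x y = (1 / τ) * s ((y - r x) / τ)) :
      Measurable (Function.uncurry p) := by
    have hp' : Function.uncurry p = fun z => (1 / τ) * s ((z.2 - r z.1) / τ) :=
      funext fun z => hp z.1 z.2
    rw [hp']
    fun_prop
  have hfstar_nonneg (x y) : 0 ≤ fstar x y := by
    rw [hfstar]
    exact mul_nonneg (by positivity) (hs_nonneg _)
  have h_split {p : (Fin d → ℝ) → ℝ → ℝ} (hp : Measurable (Function.uncurry p)) :
      J d γ g p gx = J d γ fstar p (fun x => (1 - ε x) * gx x) +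
        J d γ δ p (fun x => ε x * gx x) :=
    J_mixture (h_meas hqstar hfstar) hδ_meas hp hgx_meas hε_meas hε_nonneg
      (fun x => (hε_lt x).le) hfstar_nonneg hδ_nonneg hg
  have hw_meas : Measurable fun x => (1 - ε x) * gx x :=
    (measurable_const.sub hε_meas).mul hgx_meas
  obtain ⟨C, hC_pos, hC_fin, hC⟩ :=
    exists_J_self_eq_mul_lintegral hγ hs_nonneg hs_pow_int hs_pow_pos hσ q f hf
  obtain ⟨D, hD_pos, hD_fin, hD⟩ :=
    exists_J_self_eq_mul_lintegral hγ hs_nonneg hs_pow_int hs_pow_pos hσstar qstar fstar hfstar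
  have h_mass : ∫⁻ x, ENNReal.ofReal (gx x) = 1 := by
    rw [← ofReal_integral_eq_lintegral_ofReal hgx_int (ae_of_all _ hgx_nonneg), hgx_prob,
      ENNReal.ofReal_one]
  have hm : 0 < (∫⁻ x, ENNReal.ofReal ((1 - ε x) * gx x)).toReal := by
    refine ENNReal.toReal_pos (fun h => ?_) (ne_top_of_le_ne_top ENNReal.one_ne_top ?_)
    · rw [hD _ hw_meas, h, mul_zero] at hAs_pos
      exact hAs_pos.false
    · rw [← h_mass]
      refine lintegral_mono fun x => ENNReal.ofReal_le_ofReal ?_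
      exact mul_le_of_le_one_left (hgx_nonneg x) (by linarith [hε_nonneg x])
  have hC' := ENNReal.toReal_pos hC_pos.ne' hC_fin
  have hD' := ENNReal.toReal_pos hD_pos.ne' hD_fin
  have hAf := ENNReal.toReal_pos hAf_pos.ne' hAf_fin
  have hAs := ENNReal.toReal_pos hAs_pos.ne' hAs_fin
  obtain ⟨hf_lower, hf_upper⟩ := log_add_sub_log_mem_Icc hAf
    (ENNReal.toReal_nonneg (a := J d γ δ f (fun x => ε x * gx x)))
  obtain ⟨hs_lower, hs_upper⟩ := log_add_sub_log_mem_Icc hAs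
    (ENNReal.toReal_nonneg (a := J d γ δ fstar (fun x => ε x * gx x)))
  rw [← ENNReal.toReal_add hAf_fin hTf_fin, ← h_split (h_meas hq hf)] at hf_lower hf_upper
  rw [← ENNReal.toReal_add hAs_fin hTs_fin, ← h_split (h_meas hqstar hfstar)]
    at hs_lower hs_upper
  have h_self_f : Real.log (J d γ f f fun x => (1 - ε x) * gx x).toReal =
      Real.log (J d γ f f gx).toReal +
        Real.log (∫⁻ x, ENNReal.ofReal ((1 - ε x) * gx x)).toReal := by
    rw [hC _ hw_meas, hC _ hgx_meas, h_mass, mul_one, ENNReal.toReal_mul,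
      Real.log_mul hC'.ne' hm.ne']
  have h_self_fstar : Real.log (J d γ fstar fstar fun x => (1 - ε x) * gx x).toReal =
      Real.log (J d γ fstar fstar gx).toReal +
        Real.log (∫⁻ x, ENNReal.ofReal ((1 - ε x) * gx x)).toReal := by
    rw [hD _ hw_meas, hD _ hgx_meas, h_mass, mul_one, ENNReal.toReal_mul,
      Real.log_mul hD'.ne' hm.ne']
  have h_eq : Dgam d γ g f gx - Dgam d γ g fstar gx -
      Dgam d γ fstar f (fun x => (1 - ε x) * gx x) =
      (1 / γ) * ((Real.log (J d γ g fstar gx).toReal -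
          Real.log (J d γ fstar fstar fun x => (1 - ε x) * gx x).toReal) -
        (Real.log (J d γ g f gx).toReal -
          Real.log (J d γ fstar f fun x => (1 - ε x) * gx x).toReal)) := by
    unfold Dgam dgam
    linear_combination (-(1 / (1 + γ))) * h_self_f + (1 / (1 + γ)) * h_self_fstar
  rw [h_eq, abs_mul, abs_of_pos (one_div_pos.2 hγ)]
  gcongr
  rw [abs_le]
  constructor <;> linarith
end
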